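/- arXiv:1902.02368 — 2 statements merged into one kernel-verified Lean document; each statement's English description precedes it below -/
import Mathlib

section
/- The function V₁ solves the linear ODE 0 = 1/cosh(√2 x) − 2√2·tanh(√2 x)·V₁(x) + V₁′(x) for all x > 0, and V₁ is bounded on [0,∞). -/
open Real

/-- `V₁(x) = (1/√2)·arctan(e^{−√2 x})·cosh²(√2 x) − sinh(√2 x)/(2√2)`. -/
noncomputable def V1 (x : ℝ) : ℝ :=
  (1 / Real.sqrt 2) * Real.arctan (Real.exp (-(Real.sqrt 2 * x))) * Real.cosh (Real.sqrt 2 * x) ^ 2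
    - Real.sinh (Real.sqrt 2 * x) / (2 * Real.sqrt 2)

theorem Real.arctan_le_self_of_nonneg {t : ℝ} (ht : 0 ≤ t) : arctan t ≤ t := by
  simpa only [tan_arctan] using le_tan (arctan_nonneg.2 ht) (arctan_lt_pi_div_two t)

theorem Real.div_one_add_sq_le_arctan {t : ℝ} (ht : 0 ≤ t) : t / (1 + t ^ 2) ≤ arctan t := by
  have h : sin (arctan t) * cos (arctan t) = t / (1 + t ^ 2) := by
    rw [sin_arctan, cos_arctan, div_mul_div_comm, mul_one, mul_self_sqrt (by positivity)]
  have h₂ := sin_le (mul_nonneg zero_le_two (arctan_nonneg.2 ht))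
  rw [sin_two_mul, mul_assoc, h] at h₂
  linarith

theorem Real.hasDerivAt_arctan_exp_neg (y : ℝ) :
    HasDerivAt (fun y => arctan (exp (-y))) (-(1 / (2 * cosh y))) y := by
  convert (hasDerivAt_neg y).exp.arctan using 1
  rw [cosh_eq, exp_neg]
  field_simp

theorem hasDerivAt_V1 (x : ℝ) :
    HasDerivAt V1 (2 * arctan (exp (-(√2 * x))) * cosh (√2 * x) * sinh (√2 * x)
      - cosh (√2 * x)) x := by
  have hl : HasDerivAt (fun x : ℝ => √2 * x) √2 x := by
    simpa using (hasDerivAt_id x).const_mul √2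
  have hA := (hasDerivAt_arctan_exp_neg (√2 * x)).comp x hl
  have h := ((hA.const_mul (1 / √2)).mul (hl.cosh.pow 2)).sub (hl.sinh.div_const (2 * √2))
  refine HasDerivAt.congr_deriv h ?_
  have hc := (cosh_pos (√2 * x)).ne'
  simp only [Function.comp_apply, Pi.pow_apply]
  field_simp
  ring

theorem V1_eq_div_sqrt_two (x : ℝ) :
    V1 x = (arctan (exp (-(√2 * x))) * cosh (√2 * x) ^ 2 - sinh (√2 * x) / 2) / √2 := by
  rw [V1]
  field_simp

theorem Real.arctan_exp_neg_mul_cosh_sq_sub_mem_Icc {y : ℝ} (hy : 0 ≤ y) :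
    arctan (exp (-y)) * cosh y ^ 2 - sinh y / 2 ∈ Set.Icc 0 1 := by
  have ht : 0 < exp (-y) := exp_pos _
  have ht₁ : exp (-y) ≤ 1 := exp_le_one_iff.2 (by linarith)
  have hl := div_one_add_sq_le_arctan ht.le
  have hu := arctan_le_self_of_nonneg ht.le
  have hexp : exp y = (exp (-y))⁻¹ := by rw [exp_neg, inv_inv]
  rw [cosh_eq, sinh_eq, hexp]
  generalize exp (-y) = t at *
  have hsq : 0 ≤ ((t⁻¹ + t) / 2) ^ 2 := sq_nonneg _
  have hl' := mul_le_mul_of_nonneg_right hl hsq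
  have hu' := mul_le_mul_of_nonneg_right hu hsq
  have el : t / (1 + t ^ 2) * ((t⁻¹ + t) / 2) ^ 2 = (t⁻¹ - t) / 2 / 2 + t / 2 := by
    field_simp
    ring
  have eu : t * ((t⁻¹ + t) / 2) ^ 2 = (t⁻¹ - t) / 2 / 2 + (3 * t + t ^ 3) / 4 := by
    field_simp
    ring
  have ht₃ : t ^ 3 ≤ 1 := pow_le_one₀ ht.le ht₁
  constructor <;> linarith

/-- `V₁` solves the linear ODE
`0 = 1/cosh(√2 x) − 2√2·tanh(√2 x)·V₁(x) + V₁′(x)` for all `x > 0`, and `V₁` is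
bounded on `[0,∞)`. -/
theorem V1_ode_and_bounded :
    (∀ x : ℝ, 0 < x →
      0 = 1 / Real.cosh (Real.sqrt 2 * x)
        - 2 * Real.sqrt 2 * Real.tanh (Real.sqrt 2 * x) * V1 x + deriv V1 x) ∧
    (∃ C : ℝ, ∀ x : ℝ, 0 ≤ x → |V1 x| ≤ C) := by
  refine ⟨fun x _ => ?_, 1 / √2, fun x hx => ?_⟩
  · rw [(hasDerivAt_V1 x).deriv, V1_eq_div_sqrt_two, tanh_eq_sinh_div_cosh]
    have hc := (cosh_pos (√2 * x)).ne'
    field_simp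
    linear_combination cosh_sq (√2 * x)
  · obtain ⟨h₀, h₁⟩ := arctan_exp_neg_mul_cosh_sq_sub_mem_Icc (y := √2 * x) (by positivity)
    rw [V1_eq_div_sqrt_two, abs_of_nonneg (by positivity)]
    gcongr
end

section
/- Uniqueness of the bounded solution: if B : (0,∞) → ℝ is differentiable, bounded, and satisfies 0 = 1/cosh(√2 x) − 2√2·tanh(√2 x)·B(x) + B′(x) for all x > 0, then B(x) = V₁(x) for all x > 0. -/
open Real

open Filter Topology in
theorem tendsto_cosh_atTop_atTop : Tendsto Real.cosh atTop atTop := by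
  refine tendsto_atTop_mono (fun x => ?_) (Real.tendsto_exp_atTop.atTop_div_const two_pos)
  rw [Real.cosh_eq]
  linarith [Real.exp_pos (-x)]

theorem hasDerivAt_cosh_mul_sq (a x : ℝ) :
    HasDerivAt (fun t => Real.cosh (a * t) ^ 2)
      (2 * a * Real.tanh (a * x) * Real.cosh (a * x) ^ 2) x := by
  have hlin : HasDerivAt (fun t : ℝ => a * t) a x := by
    simpa using (hasDerivAt_id x).const_mul a
  have hcosh := (Real.cosh_pos (a * x)).ne'
  refine (hlin.cosh.fun_pow 2).congr_deriv ?_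
  rw [Real.tanh_eq_sinh_div_cosh]
  field_simp
  norm_num
  ring

theorem hasDerivAt_arctan_exp_neg_mul (a x : ℝ) :
    HasDerivAt (fun t => Real.arctan (Real.exp (-(a * t))))
      (-a / (2 * Real.cosh (a * x))) x := by
  have hlin : HasDerivAt (fun t : ℝ => -(a * t)) (-a) x := by
    simpa using ((hasDerivAt_id x).const_mul a).fun_neg
  have he := Real.exp_pos (a * x)
  refine hlin.exp.arctan.congr_deriv ?_
  rw [Real.cosh_eq, Real.exp_neg]
  field_simp

theorem hasDerivAt_V1_s16 (x : ℝ) :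
    HasDerivAt V1
      (2 * Real.sqrt 2 * Real.tanh (Real.sqrt 2 * x) * V1 x
        - 1 / Real.cosh (Real.sqrt 2 * x)) x := by
  have hlin : HasDerivAt (fun t : ℝ => Real.sqrt 2 * t) (Real.sqrt 2) x := by
    simpa using (hasDerivAt_id x).const_mul (Real.sqrt 2)
  have hcosh := (Real.cosh_pos (Real.sqrt 2 * x)).ne'
  have hsqrt : Real.sqrt 2 ≠ 0 := by positivity
  have hV := ((((hasDerivAt_arctan_exp_neg_mul (Real.sqrt 2) x).const_mul
    (1 / Real.sqrt 2)).mul (hasDerivAt_cosh_mul_sq (Real.sqrt 2) x)).sub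
    (hlin.sinh.div_const (2 * Real.sqrt 2)))
  refine HasDerivAt.congr_deriv (f := V1) hV ?_
  rw [V1, Real.tanh_eq_sinh_div_cosh]
  field_simp
  linear_combination (-2 : ℝ) * Real.cosh_sq (Real.sqrt 2 * x)

open Filter Topology in
theorem tendsto_V1_div_cosh_sq :
    Tendsto (fun x => V1 x / Real.cosh (Real.sqrt 2 * x) ^ 2) atTop (𝓝 0) := by
  have hlin : Tendsto (fun x : ℝ => Real.sqrt 2 * x) atTop atTop :=
    tendsto_id.const_mul_atTop (by positivity)
  have harctan : Tendsto (fun x : ℝ => Real.arctan (Real.exp (-(Real.sqrt 2 * x))))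
      atTop (𝓝 0) := by
    simpa [Function.comp_def] using (Real.continuous_arctan.tendsto 0).comp
      (Real.tendsto_exp_neg_atTop_nhds_zero.comp hlin)
  have hinv : Tendsto (fun x : ℝ => (Real.cosh (Real.sqrt 2 * x))⁻¹) atTop (𝓝 0) :=
    (tendsto_cosh_atTop_atTop.comp hlin).inv_tendsto_atTop
  have htanh : Tendsto (fun x : ℝ => Real.tanh (Real.sqrt 2 * x) *
      (Real.cosh (Real.sqrt 2 * x))⁻¹) atTop (𝓝 0) := by
    refine squeeze_zero_norm (fun x => ?_) hinv
    rw [norm_mul, Real.norm_eq_abs, Real.norm_eq_abs,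
      abs_of_pos (inv_pos.2 (Real.cosh_pos _))]
    exact mul_le_of_le_one_left (inv_pos.2 (Real.cosh_pos _)).le (Real.abs_tanh_lt_one _).le
  have hlim := (harctan.const_mul (1 / Real.sqrt 2)).sub (htanh.div_const (2 * Real.sqrt 2))
  simp only [mul_zero, zero_div, sub_zero] at hlim
  refine hlim.congr fun x => ?_
  have hcosh := (Real.cosh_pos (Real.sqrt 2 * x)).ne'
  rw [V1, Real.tanh_eq_sinh_div_cosh]
  field_simp

open Filter Topology in
theorem tendsto_div_cosh_sq_of_bounded {B : ℝ → ℝ} {C : ℝ} (hB : ∀ x : ℝ, 0 < x → |B x| ≤ C) :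
    Tendsto (fun x => B x / Real.cosh (Real.sqrt 2 * x) ^ 2) atTop (𝓝 0) := by
  have hlin : Tendsto (fun x : ℝ => Real.sqrt 2 * x) atTop atTop :=
    tendsto_id.const_mul_atTop (by positivity)
  have hlim : Tendsto (fun x : ℝ => C / Real.cosh (Real.sqrt 2 * x) ^ 2) atTop (𝓝 0) :=
    ((tendsto_pow_atTop two_ne_zero).comp
      (tendsto_cosh_atTop_atTop.comp hlin)).const_div_atTop C
  refine squeeze_zero_norm' ?_ hlim
  filter_upwards [eventually_gt_atTop 0] with x hx
  rw [norm_div, Real.norm_eq_abs, Real.norm_eq_abs, abs_of_nonneg (sq_nonneg (Real.cosh _))]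
  exact div_le_div_of_nonneg_right (hB x hx) (sq_nonneg _)

/-- uniqueness of the bounded solution of the ODE: any differentiable,
bounded `B` on `(0,∞)` solving `0 = 1/cosh(√2 x) − 2√2·tanh(√2 x)·B(x) + B′(x)`
coincides with `V₁` on `(0,∞)`. -/
theorem bounded_ode_solution_unique (B : ℝ → ℝ)
    (hdiff : ∀ x : ℝ, 0 < x → DifferentiableAt ℝ B x)
    (hbdd : ∃ C : ℝ, ∀ x : ℝ, 0 < x → |B x| ≤ C)
    (hode : ∀ x : ℝ, 0 < x →
      0 = 1 / Real.cosh (Real.sqrt 2 * x)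
        - 2 * Real.sqrt 2 * Real.tanh (Real.sqrt 2 * x) * B x + deriv B x) :
    ∀ x : ℝ, 0 < x → B x = V1 x := by
  obtain ⟨C, hC⟩ := hbdd
  intro x hx
  have hcosh (t : ℝ) : Real.cosh (Real.sqrt 2 * t) ≠ 0 := (Real.cosh_pos _).ne'
  set q : ℝ → ℝ := fun t => (B t - V1 t) / Real.cosh (Real.sqrt 2 * t) ^ 2 with hq
  have hderiv (t : ℝ) (ht : 0 < t) : HasDerivAt q 0 t := by
    refine (((hdiff t ht).hasDerivAt.sub (hasDerivAt_V1_s16 t)).div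
      (hasDerivAt_cosh_mul_sq (Real.sqrt 2) t) (pow_ne_zero 2 (hcosh t))).congr_deriv ?_
    rw [div_eq_zero_iff]
    left
    simp only [Pi.sub_apply]
    linear_combination (-Real.cosh (Real.sqrt 2 * t) ^ 2) * hode t ht
  have hconst (t : ℝ) (ht : 0 < t) : q t = q x :=
    isOpen_Ioi.is_const_of_deriv_eq_zero isPreconnected_Ioi
      (fun u hu => (hderiv u hu).differentiableAt.differentiableWithinAt)
      (fun u hu => (hderiv u hu).deriv) ht hx
  have hlim : Filter.Tendsto q Filter.atTop (nhds 0) := by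
    simpa only [hq, sub_div, sub_zero] using
      (tendsto_div_cosh_sq_of_bounded hC).sub tendsto_V1_div_cosh_sq
  have hzero : q x = 0 := by
    refine tendsto_nhds_unique (Filter.Tendsto.congr' ?_ tendsto_const_nhds) hlim
    filter_upwards [Filter.eventually_gt_atTop 0] with t ht using (hconst t ht).symm
  have hnum := (div_eq_zero_iff.1 hzero).resolve_right (pow_ne_zero 2 (hcosh x))
  exact sub_eq_zero.1 hnum
end
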